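/- For all 0 ≤ α₁ ≤ α₂ ≤ 1, λ_max((1−2α₁)D − W) − λ_max((1−2α₂)D − W) ≥ 2(α₂−α₁)·min_{1≤i≤N} d_i ≥ 0; in particular, the map α ↦ λ_max((1−2α)D − W) is nonincreasing on [0,1]. -/

import Mathlib

open Matrix Finset

/-- Degree matrix `D = diag(d_1, …, d_N)` with `d_i = Σ_j W i j`. -/
noncomputable def degMat {N : ℕ} (W : Matrix (Fin N) (Fin N) ℝ) : Matrix (Fin N) (Fin N) ℝ :=
  Matrix.diagonal (fun i => ∑ j, W i j)

/-- `μ` is the largest eigenvalue of `A`. -/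
def IsMaxEig {N : ℕ} (A : Matrix (Fin N) (Fin N) ℝ) (μ : ℝ) : Prop :=
  (∃ v : Fin N → ℝ, v ≠ 0 ∧ A.mulVec v = μ • v) ∧
  ∀ ν : ℝ, (∃ v : Fin N → ℝ, v ≠ 0 ∧ A.mulVec v = ν • v) → ν ≤ μ

/-- The quadratic form of a symmetric matrix is bounded by its largest eigenvalue. -/
theorem IsMaxEig.dotProduct_mulVec_le {N : ℕ} {A : Matrix (Fin N) (Fin N) ℝ} {μ : ℝ}
    (hA : A.IsSymm) (hμ : IsMaxEig A μ) (v : Fin N → ℝ) :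
    v ⬝ᵥ A *ᵥ v ≤ μ * (v ⬝ᵥ v) := by
  have hB : (μ • (1 : Matrix (Fin N) (Fin N) ℝ) - A).IsHermitian := by
    rw [Matrix.IsHermitian, Matrix.conjTranspose_eq_transpose_of_trivial]
    simp [hA.eq]
  have hpos : (μ • (1 : Matrix (Fin N) (Fin N) ℝ) - A).PosSemidef := by
    refine hB.posSemidef_iff_eigenvalues_nonneg.mpr fun i => ?_
    have hu := hB.mulVec_eigenvectorBasis i
    rw [Matrix.sub_mulVec, Matrix.smul_mulVec, Matrix.one_mulVec] at hu
    have hle := hμ.2 (μ - hB.eigenvalues i) ⟨⇑(hB.eigenvectorBasis i), ?_, ?_⟩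
    · simpa using hle
    · intro h
      exact hB.eigenvectorBasis.orthonormal.ne_zero i (by ext j; exact congrFun h j)
    · rw [sub_smul, ← hu, sub_sub_cancel]
  have h := hpos.dotProduct_mulVec_nonneg v
  rw [star_trivial, Matrix.sub_mulVec, Matrix.smul_mulVec, Matrix.one_mulVec, dotProduct_sub,
    dotProduct_smul, smul_eq_mul] at h
  linarith

/-- The quadratic form of the degree matrix is bounded below by any lower bound on the degrees. -/
theorem le_dotProduct_degMat_mulVec {N : ℕ} {W : Matrix (Fin N) (Fin N) ℝ} {m : ℝ}
    (hm : ∀ i, m ≤ ∑ j, W i j) (v : Fin N → ℝ) :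
    m * (v ⬝ᵥ v) ≤ v ⬝ᵥ degMat W *ᵥ v := by
  simp only [dotProduct, degMat, Matrix.mulVec_diagonal, Finset.mul_sum]
  refine Finset.sum_le_sum fun i _ => ?_
  nlinarith [mul_le_mul_of_nonneg_right (hm i) (mul_self_nonneg (v i))]

/-- for all `0 ≤ α₁ ≤ α₂ ≤ 1`,
`λ_max((1−2α₁)D − W) − λ_max((1−2α₂)D − W) ≥ 2(α₂−α₁)·min_i d_i ≥ 0`;
in particular `α ↦ λ_max((1−2α)D − W)` is nonincreasing on `[0,1]`. -/
theorem stmt10 {N : ℕ} (hN : 0 < N) (W : Matrix (Fin N) (Fin N) ℝ)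
    (hsymm : W.IsSymm) (h01 : ∀ i j, W i j = 0 ∨ W i j = 1)
    (hdiag : ∀ i, W i i = 0)
    (α₁ α₂ : ℝ) (h0 : 0 ≤ α₁) (h12 : α₁ ≤ α₂) (h1 : α₂ ≤ 1)
    (lam₁ lam₂ : ℝ)
    (hlam₁ : IsMaxEig ((1 - 2*α₁) • degMat W - W) lam₁)
    (hlam₂ : IsMaxEig ((1 - 2*α₂) • degMat W - W) lam₂) :
    2 * (α₂ - α₁) * (Finset.univ.inf' ⟨⟨0, hN⟩, Finset.mem_univ _⟩ (fun i => ∑ j, W i j))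
      ≤ lam₁ - lam₂ ∧
    0 ≤ 2 * (α₂ - α₁) * (Finset.univ.inf' ⟨⟨0, hN⟩, Finset.mem_univ _⟩ (fun i => ∑ j, W i j)) ∧
    lam₂ ≤ lam₁ := by
  set m := Finset.univ.inf' ⟨⟨0, hN⟩, Finset.mem_univ _⟩ (fun i => ∑ j, W i j)
  have hm : ∀ i, m ≤ ∑ j, W i j := fun i => Finset.inf'_le _ (Finset.mem_univ i)
  have hm0 : 0 ≤ m := Finset.le_inf' _ _ fun i _ => Finset.sum_nonneg fun j _ => by
    rcases h01 i j with h | h <;> simp [h]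
  have hnonneg : 0 ≤ 2 * (α₂ - α₁) * m := mul_nonneg (by linarith) hm0
  have hgap : 2 * (α₂ - α₁) * m ≤ lam₁ - lam₂ := by
    obtain ⟨⟨v, hv, hev⟩, -⟩ := hlam₂
    have hA : ((1 - 2*α₁) • degMat W - W).IsSymm :=
      ((Matrix.isSymm_diagonal _).smul _).sub hsymm
    have hup := hlam₁.dotProduct_mulVec_le hA v
    have hlow := le_dotProduct_degMat_mulVec hm v
    have hvv : 0 < v ⬝ᵥ v := by
      simpa using Matrix.dotProduct_star_self_pos_iff.mpr hv
    have hquad := congrArg (v ⬝ᵥ ·) hev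
    simp only [Matrix.sub_mulVec, Matrix.smul_mulVec, dotProduct_sub, dotProduct_smul,
      smul_eq_mul] at hup hquad
    refine le_of_mul_le_mul_right ?_ hvv
    nlinarith [mul_le_mul_of_nonneg_left hlow (by linarith : 0 ≤ 2 * (α₂ - α₁))]
  exact ⟨hgap, hnonneg, by linarith⟩
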